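/- arXiv:0904.4589 — 3 statements merged into one kernel-verified Lean document; each statement's English description precedes it below -/
import Mathlib

section
/- Let K be a compact convex set in an n-dimensional real affine space, and let Φ be an affine map of the ambient space into itself with Φ(K) ⊆ K. If there exist n+1 affinely independent points in Φ(K) each of which is an extreme point of K, then Φ is an extreme point of the convex set of affine maps sending K into K. -/
/-- Let K be a compact convex set in an n-dimensional real affine
space (modeled here by a real vector space E with finrank = n), and Φ an affine
self-map of E with Φ(K) ⊆ K. If Φ(K) contains n+1 affinely independent extreme
points of K, then Φ is an extreme point of the convex set of affine maps
sending K into K. -/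
theorem stmt_0 {E : Type*} [AddCommGroup E] [Module ℝ E]
    [TopologicalSpace E] [FiniteDimensional ℝ E]
    (n : ℕ) (hn : Module.finrank ℝ E = n)
    (K : Set E) (hKc : IsCompact K) (hKconv : Convex ℝ K)
    (Φ : E →ᵃ[ℝ] E) (hΦ : Φ '' K ⊆ K)
    (q : Fin (n + 1) → E)
    (hq_im : ∀ i, q i ∈ Φ '' K)
    (hq_ext : ∀ i, q i ∈ Set.extremePoints ℝ K)
    (hq_ind : AffineIndependent ℝ q) :
    Φ ∈ Set.extremePoints ℝ {Ψ : E →ᵃ[ℝ] E | Ψ '' K ⊆ K} := by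
  classical
  choose p hpK hp using hq_im
  have hpq : (Φ ∘ p) = q := funext hp
  have hp_ind : AffineIndependent ℝ p := by
    apply AffineIndependent.of_comp Φ
    rw [hpq]
    exact hq_ind
  have hspan : affineSpan ℝ (Set.range p) = ⊤ := by
    rw [hp_ind.affineSpan_eq_top_iff_card_eq_finrank_add_one]
    simp [hn]
  refine ⟨hΦ, ?_⟩
  intro Φ₁ h₁ Φ₂ h₂ hseg
  apply AffineMap.ext_on hspan
  rintro _ ⟨i, rfl⟩
  rw [hp i]
  refine (hq_ext i).2 (h₁ ⟨p i, hpK i, rfl⟩) (h₂ ⟨p i, hpK i, rfl⟩) ?_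
  obtain ⟨a, b, ha, hb, hab, h⟩ := hseg
  refine ⟨a, b, ha, hb, hab, ?_⟩
  rw [← hp i, ← h]
  simp
end

section
/- Every fix-extreme positive map of the closed unit ball in a Euclidean space (i.e., an affine map sending the ball into itself whose image contains n+1 affinely independent extreme points of the ball) is an extreme point of the convex set of affine self-maps of the ball, and is in fact an orthogonal transformation. -/
/-- Every fix-extreme positive map of the closed unit ball B of an
n-dimensional Euclidean space (an affine map sending B into B whose image
contains n+1 affinely independent extreme points of B, i.e. points of the unit
sphere) is an extreme point of the convex set of affine self-maps of B, and is
an orthogonal transformation. -/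
theorem stmt_5 {E : Type*} [NormedAddCommGroup E] [InnerProductSpace ℝ E]
    [FiniteDimensional ℝ E]
    (n : ℕ) (hn : Module.finrank ℝ E = n)
    (Φ : E →ᵃ[ℝ] E)
    (hΦ : Φ '' Metric.closedBall (0 : E) 1 ⊆ Metric.closedBall (0 : E) 1)
    (q : Fin (n + 1) → E)
    (hq_im : ∀ j, q j ∈ Φ '' Metric.closedBall (0 : E) 1)
    (hq_ext : ∀ j, q j ∈ Set.extremePoints ℝ (Metric.closedBall (0 : E) 1))
    (hq_ind : AffineIndependent ℝ q) :
    Φ ∈ Set.extremePoints ℝ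
        {Ψ : E →ᵃ[ℝ] E | Ψ '' Metric.closedBall (0 : E) 1 ⊆ Metric.closedBall (0 : E) 1} ∧
      ∃ O : E ≃ₗᵢ[ℝ] E, ∀ x, Φ x = O x := by
  choose p hpB hpq using hq_im
  have hcomp : (Φ ∘ p) = q := funext hpq
  have hp_ind : AffineIndependent ℝ p :=
    AffineIndependent.of_comp Φ (by rw [hcomp]; exact hq_ind)
  have hspan : affineSpan ℝ (Set.range p) = ⊤ := by
    rw [hp_ind.affineSpan_eq_top_iff_card_eq_finrank_add_one, Fintype.card_fin, hn]
  have hagree : ∀ f g : E →ᵃ[ℝ] E, (∀ j, f (p j) = g (p j)) → f = g := by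
    intro f g h
    apply AffineMap.ext_on hspan
    rintro _ ⟨j, rfl⟩
    exact h j
  refine ⟨⟨hΦ, ?_⟩, ?_⟩
  · rintro Ψ₁ h₁ Ψ₂ h₂ ⟨a, b, ha, hb, hab, hΨ⟩
    apply hagree
    intro j
    rw [hpq j]
    refine (hq_ext j).2 (h₁ ⟨p j, hpB j, rfl⟩) (h₂ ⟨p j, hpB j, rfl⟩) ⟨a, b, ha, hb, hab, ?_⟩
    rw [← hpq j, ← hΨ]
    simp
  rcases subsingleton_or_nontrivial E with hE | hE
  · exact ⟨LinearIsometryEquiv.refl ℝ E, fun x => Subsingleton.elim _ _⟩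
  have hn0 : 0 < n := hn ▸ Module.finrank_pos
  have hq1 : ∀ j, ‖q j‖ = 1 := fun j => by
    simpa using extremePoints_closedBall_subset_sphere (hq_ext j)
  have hp1 : ∀ j, ‖p j‖ ≤ 1 := fun j => by simpa using hpB j
  have hΦ1 : ∀ x, ‖x‖ ≤ 1 → ‖Φ x‖ ≤ 1 := fun x hx => by
    simpa using hΦ ⟨x, by simpa using hx, rfl⟩
  obtain ⟨L, hL⟩ : ∃ L : E →ₗ[ℝ] E, L = Φ.linear := ⟨_, rfl⟩
  obtain ⟨b, hb⟩ : ∃ b : E, b = Φ 0 := ⟨_, rfl⟩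
  have hdec : ∀ x, Φ x = L x + b := fun x => by
    rw [hL, hb]; exact congrFun Φ.decomp x
  have hadj : ∀ x y, inner ℝ (L.adjoint x) y = inner ℝ x (L y) := fun x y =>
    LinearMap.adjoint_inner_left L y x
  have hqq : ∀ j, inner ℝ (q j) (q j) = (1 : ℝ) := fun j => by
    rw [real_inner_self_eq_norm_sq, hq1]; norm_num
  -- the functional ⟪L† q, ·⟫ is maximal on the ball at p
  have hmax : ∀ j x, ‖x‖ ≤ 1 →
      inner ℝ (L.adjoint (q j)) x ≤ inner ℝ (L.adjoint (q j)) (p j) := by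
    intro j x hx
    have h1 : inner ℝ (q j) (Φ x) ≤ (1 : ℝ) := by
      refine (real_inner_le_norm _ _).trans ?_
      rw [hq1, one_mul]; exact hΦ1 x hx
    have h2 : inner ℝ (q j) (Φ (p j)) = (1 : ℝ) := by rw [hpq]; exact hqq j
    rw [hdec, inner_add_right] at h1 h2
    rw [hadj, hadj]
    linarith
  have hv0 : ∀ j, L.adjoint (q j) ≠ 0 := by
    intro j h0
    have hall : ∀ i, q i = q j := by
      intro i
      have hi : inner ℝ (q j) (L (p i)) = (0 : ℝ) := by rw [← hadj, h0, inner_zero_left]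
      have hj : inner ℝ (q j) (L (p j)) = (0 : ℝ) := by rw [← hadj, h0, inner_zero_left]
      have e1 : inner ℝ (q j) (q i) = (inner ℝ (q j) b : ℝ) := by
        rw [← hpq i, hdec, inner_add_right, hi, zero_add]
      have e2 : (1 : ℝ) = (inner ℝ (q j) b : ℝ) := by
        rw [← hqq j]; nth_rewrite 2 [← hpq j]
        rw [hdec, inner_add_right, hj, zero_add]
      exact ((inner_eq_one_iff_of_norm_eq_one (𝕜 := ℝ) (hq1 j) (hq1 i)).1 (e1.trans e2.symm)).symm
    have : (0 : Fin (n + 1)) = Fin.last n :=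
      hq_ind.injective ((hall _).trans (hall _).symm)
    have := congrArg Fin.val this
    simp at this
    omega
  have hvp : ∀ j, ‖L.adjoint (q j)‖ ≤ inner ℝ (L.adjoint (q j)) (p j) := by
    intro j
    have hpos : 0 < ‖L.adjoint (q j)‖ := norm_pos_iff.2 (hv0 j)
    have := hmax j (‖L.adjoint (q j)‖⁻¹ • L.adjoint (q j)) (by
      rw [norm_smul, norm_inv, norm_norm, inv_mul_cancel₀ hpos.ne'])
    rw [inner_smul_right, real_inner_self_eq_norm_sq, sq, ← mul_assoc,
      inv_mul_cancel₀ hpos.ne', one_mul] at this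
    exact this
  have hpn : ∀ j, ‖p j‖ = 1 := by
    intro j
    have hpos : 0 < ‖L.adjoint (q j)‖ := norm_pos_iff.2 (hv0 j)
    have h := (hvp j).trans (real_inner_le_norm _ _)
    refine le_antisymm (hp1 j) ?_
    by_contra! hlt
    nlinarith
  have hpp : ∀ j, inner ℝ (p j) (p j) = (1 : ℝ) := fun j => by
    rw [real_inner_self_eq_norm_sq, hpn]; norm_num
  have hv : ∀ j, L.adjoint (q j) = ‖L.adjoint (q j)‖ • p j := by
    intro j
    have h := hvp j
    have hsq : ‖L.adjoint (q j) - ‖L.adjoint (q j)‖ • p j‖ ^ 2 ≤ 0 := by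
      rw [norm_sub_sq_real, norm_smul, norm_norm, hpn, inner_smul_right]
      nlinarith [norm_nonneg (L.adjoint (q j))]
    rw [← sub_eq_zero, ← norm_eq_zero]
    exact pow_eq_zero_iff (two_ne_zero) |>.1 (le_antisymm hsq (sq_nonneg _))
  obtain ⟨c, hc⟩ : ∃ c : Fin (n + 1) → ℝ, ∀ j, c j = ‖L.adjoint (q j)‖ := ⟨_, fun _ => rfl⟩
  have hv' : ∀ j, L.adjoint (q j) = c j • p j := fun j => by rw [hc]; exact hv j
  have hcpos : ∀ j, 0 < c j := fun j => by rw [hc]; exact norm_pos_iff.2 (hv0 j)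
  have hLq : ∀ j x, inner ℝ (q j) (L x) = c j * inner ℝ (p j) x := fun j x => by
    rw [← hadj, hv', real_inner_smul_left]
  have hb1 : ∀ j, inner ℝ (q j) b = 1 - c j := by
    intro j
    have h2 : inner ℝ (q j) (Φ (p j)) = (1 : ℝ) := by rw [hpq]; exact hqq j
    rw [hdec, inner_add_right, hLq, hpp] at h2
    linarith
  have hrel : ∀ i j, 1 - inner ℝ (q j) (q i) = c j * (1 - inner ℝ (p j) (p i)) := by
    intro i j
    have : inner ℝ (q j) (Φ (p i)) = (inner ℝ (q j) (q i) : ℝ) := by rw [hpq]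
    rw [hdec, inner_add_right, hLq, hb1] at this
    linarith
  have hceq : ∀ i j, c i = c j := by
    intro i j
    by_cases hij : i = j
    · rw [hij]
    have h1 := hrel i j
    have h2 := hrel j i
    rw [real_inner_comm (q j) (q i), real_inner_comm (p j) (p i)] at h2
    have hne : (1 : ℝ) - inner ℝ (p j) (p i) ≠ 0 := by
      intro h0
      have : inner ℝ (p j) (p i) = (1 : ℝ) := by linarith
      have := (inner_eq_one_iff_of_norm_eq_one (𝕜 := ℝ) (hpn j) (hpn i)).1 this
      exact hij (hp_ind.injective this.symm)
    exact mul_right_cancel₀ hne (h2.symm.trans h1)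
  obtain ⟨μ, hμ⟩ : ∃ μ, μ = c 0 := ⟨_, rfl⟩
  have hμpos : 0 < μ := hμ ▸ hcpos 0
  have hfun : ∀ x, L.adjoint (Φ x) = μ • x := by
    have := hagree (L.adjoint.toAffineMap.comp Φ) ((μ • LinearMap.id : E →ₗ[ℝ] E).toAffineMap) (by
      intro j
      simp [hpq, hv', hμ, hceq j 0])
    intro x
    simpa using congrArg (fun f : E →ᵃ[ℝ] E => f x) this
  have hLb : L.adjoint b = 0 := by
    have := hfun 0
    rwa [← hb, smul_zero] at this
  have hLL : ∀ x, L.adjoint (L x) = μ • x := fun x => by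
    have := hfun x
    rwa [hdec, map_add, hLb, add_zero] at this
  have hinj : Function.Injective L := by
    intro x y hxy
    have : μ • x = μ • y := by rw [← hLL, ← hLL, hxy]
    exact smul_right_injective E hμpos.ne' this
  obtain ⟨x₀, hx₀⟩ := LinearMap.injective_iff_surjective.1 hinj b
  have hb0 : b = 0 := by
    rw [← inner_self_eq_zero (𝕜 := ℝ)]
    nth_rewrite 2 [← hx₀]
    rw [← hadj, hLb, inner_zero_left]
  have hμ1 : μ = 1 := by
    have := hb1 0
    rw [hb0, inner_zero_right, ← hμ] at this
    linarith
  let O : E →ₗᵢ[ℝ] E := ⟨L, fun x => by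
    rw [← sq_eq_sq₀ (norm_nonneg _) (norm_nonneg _), ← real_inner_self_eq_norm_sq,
      ← real_inner_self_eq_norm_sq, ← hadj, hLL, hμ1, one_smul]⟩
  refine ⟨O.toLinearIsometryEquiv rfl, fun x => ?_⟩
  rw [LinearIsometry.toLinearIsometryEquiv_apply, hdec, hb0, add_zero]
  rfl
end

section
/- There exists an extreme trace-preserving (in the Heisenberg sense, unity-preserving) completely positive map on 3×3 complex matrices whose image contains no pure state: namely A with Kraus operators V₁ = diag(1/√3, 1/√2, 1/√(1+α²)), V₂ the cyclic matrix with entries (1,2)→1/√3, (2,3)→1/√2, (3,1)→α/√(1+α²), and V₃ with the single nonzero entry (1,3)→1/√3, for small α ≠ 0; then V₁V₁† + V₂V₂† + V₃V₃† = I, the nine products VᵢVⱼ† are linearly independent (so A is extreme), and no pure state ρ has Aρ of rank one. -/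
open scoped Matrix

/-- The Kraus operators V₁, V₂, V₃ of the paper's example, depending on α. -/
noncomputable def paperV (α : ℝ) : Fin 3 → Matrix (Fin 3) (Fin 3) ℂ :=
  ![!![((Real.sqrt 3)⁻¹ : ℝ), 0, 0;
      0, ((Real.sqrt 2)⁻¹ : ℝ), 0;
      0, 0, ((Real.sqrt (1 + α ^ 2))⁻¹ : ℝ)],
    !![0, ((Real.sqrt 3)⁻¹ : ℝ), 0;
      0, 0, ((Real.sqrt 2)⁻¹ : ℝ);
      (α / Real.sqrt (1 + α ^ 2) : ℝ), 0, 0],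
    !![0, 0, ((Real.sqrt 3)⁻¹ : ℝ);
      0, 0, 0;
      0, 0, 0]]

theorem paper_minor {U : Matrix (Fin 3) (Fin 3) ℂ} (h : U.rank = 1) (i j k l : Fin 3) :
    U i k * U j l = U i l * U j k := by
  rw [Matrix.rank, finrank_eq_one_iff'] at h
  obtain ⟨⟨v, hv⟩, -, h⟩ := h
  have key : ∀ k, ∃ c : ℂ, ∀ i, U i k = c * v i := by
    intro k
    obtain ⟨c, hc⟩ := h ⟨U.mulVecLin (Pi.single k 1), LinearMap.mem_range_self _ _⟩
    refine ⟨c, fun i => ?_⟩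
    have := congrFun (congrArg Subtype.val hc) i
    simpa using this.symm
  obtain ⟨c, hc⟩ := key k
  obtain ⟨d, hd⟩ := key l
  rw [hc, hd, hc, hd]; ring

/-- There exists (for small α ≠ 0) an extreme unity-preserving
completely positive map on 3×3 matrices, with the explicit Kraus operators
above, whose image contains no pure state: Σᵢ VᵢVᵢ† = I, the nine products
VᵢVⱼ† are linearly independent (so A is extreme by Choi's theorem), and no
rank-one projector |x⟩⟨x| is sent to a rank-one operator. -/
theorem stmt_18 :
    ∃ α : ℝ, α ≠ 0 ∧
      (∑ i, paperV α i * (paperV α i)ᴴ) = 1 ∧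
      LinearIndependent ℂ (fun p : Fin 3 × Fin 3 => paperV α p.1 * (paperV α p.2)ᴴ) ∧
      ∀ x : Fin 3 → ℂ, x ≠ 0 →
        (∑ i, (paperV α i)ᴴ * Matrix.vecMulVec x (star x) * paperV α i).rank ≠ 1 := by
  have h5 : Real.sqrt (1 + (3/4 : ℝ)^2) = 5/4 := by
    rw [show (1 + (3/4 : ℝ)^2) = (5/4)^2 by norm_num]
    exact Real.sqrt_sq (by norm_num)
  obtain ⟨a, ha, ha2⟩ : ∃ a : ℝ, a = (Real.sqrt 3)⁻¹ ∧ a * a = 1/3 :=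
    ⟨_, rfl, by rw [← mul_inv, Real.mul_self_sqrt (by norm_num)]; norm_num⟩
  obtain ⟨b, hb, hb2⟩ : ∃ b : ℝ, b = (Real.sqrt 2)⁻¹ ∧ b * b = 1/2 :=
    ⟨_, rfl, by rw [← mul_inv, Real.mul_self_sqrt (by norm_num)]; norm_num⟩
  have hV : paperV (3/4) = ![!![(a : ℂ), 0, 0; 0, (b : ℂ), 0; 0, 0, 4/5],
      !![0, (a : ℂ), 0; 0, 0, (b : ℂ); 3/5, 0, 0], !![0, 0, (a : ℂ); 0, 0, 0; 0, 0, 0]] := by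
    unfold paperV
    rw [h5, ← ha, ← hb]
    norm_num
  have ha0 : (a : ℂ) ≠ 0 := by
    intro h
    have h' : a = 0 := by exact_mod_cast h
    rw [h'] at ha2; norm_num at ha2
  have hb0 : (b : ℂ) ≠ 0 := by
    intro h
    have h' : b = 0 := by exact_mod_cast h
    rw [h'] at hb2; norm_num at hb2
  have ha2 : (a : ℂ) * a = 1/3 := by rw [← Complex.ofReal_mul, ha2]; norm_num
  have hb2 : (b : ℂ) * b = 1/2 := by rw [← Complex.ofReal_mul, hb2]; norm_num
  clear ha hb
  refine ⟨3/4, by norm_num, ?_, ?_, ?_⟩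
  · rw [hV]
    ext i j
    simp only [Fin.sum_univ_three, Matrix.add_apply, Matrix.mul_apply]
    fin_cases i <;> fin_cases j <;> simp [ha2, hb2] <;> norm_num
  · rw [hV, Fintype.linearIndependent_iff]
    intro g hg
    have e := fun i j => congrFun (congrFun hg i) j
    simp only [Fintype.sum_prod_type, Fin.sum_univ_three, Matrix.add_apply, Matrix.smul_apply,
      Matrix.mul_apply, Matrix.zero_apply] at e
    have e00 := e 0 0
    have e01 := e 0 1
    have e02 := e 0 2
    have e10 := e 1 0
    have e11 := e 1 1
    have e12 := e 1 2
    have e20 := e 2 0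
    have e21 := e 2 1
    have e22 := e 2 2
    clear e hg
    simp [ha2, hb2, ha0, hb0] at e00 e01 e02 e10 e11 e12 e20 e21 e22
    rw [e12] at e01 e20
    rw [e21] at e02 e10
    have f21 : g (2, 1) = 0 := by simpa [ha0, hb0] using e01
    have f20 : g (2, 0) = 0 := by simpa [ha0, hb0] using e02
    have f12 : g (1, 2) = 0 := by simpa [ha0, hb0] using e10
    have f02 : g (0, 2) = 0 := by simpa [ha0, hb0] using e20
    have f00 : g (0, 0) = 0 := by linear_combination (25 / 7) * e22 - (18 / 7) * e11
    have f11 : g (1, 1) = 0 := by linear_combination 2 * e11 - f00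
    have f22 : g (2, 2) = 0 := by linear_combination 3 * e00 - f00 - f11
    rintro ⟨i, j⟩
    fin_cases i <;> fin_cases j <;> assumption
  · intro x hx hr
    have hU : (∑ i, (paperV (3/4) i)ᴴ * Matrix.vecMulVec x (star x) * paperV (3/4) i) =
        !![a * x 0, 3/5 * x 2, 0; b * x 1, a * x 0, 0; 4/5 * x 2, b * x 1, a * x 0] *
        (!![a * x 0, 3/5 * x 2, 0; b * x 1, a * x 0, 0; 4/5 * x 2, b * x 1, a * x 0])ᴴ := by
      rw [hV]
      ext i j
      fin_cases i <;> fin_cases j <;>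
        simp [Fin.sum_univ_three, Matrix.mul_apply, Matrix.vecMulVec_apply, map_ofNat] <;> ring
    open scoped ComplexOrder in
    rw [hU, Matrix.rank_self_mul_conjTranspose] at hr
    have m := paper_minor hr
    have x0 : x 0 = 0 := by simpa [ha0] using m 1 2 1 2
    have x2 : x 2 = 0 := by simpa [ha0, x0] using m 0 2 0 1
    have x1 : x 1 = 0 := by simpa [hb0, x0, x2] using m 1 2 0 1
    apply hx
    ext i
    fin_cases i <;> simp [x0, x1, x2]
end
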